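/- For every type S, regarding the collection of all subsets of S as a Boolean algebra with the set-theoretic operations, and for every homomorphism H : Fm → 𝒫(Set S) with principal variables, there exists a map f : S → (ℕ → Bool) such that for every PT⁺ formula φ and every X ⊆ S: X ∈ H(φ) if and only if f '' X ∈ H_V(φ), where f '' X denotes the image {f(x) : x ∈ X}. -/

import Mathlib

/-- LT formulas: term algebra over variables with external connectives
`⊥, ¬, ∨, ∧` and internal connectives `i⊥, i¬, i∨, i∧`. -/
inductive Fm where
  | var  : ℕ → Fm
  | ebot : Fm
  | enot : Fm → Fm
  | eor  : Fm → Fm → Fm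
  | eand : Fm → Fm → Fm
  | ibot : Fm
  | inot : Fm → Fm
  | ior  : Fm → Fm → Fm
  | iand : Fm → Fm → Fm

/-- `H : Fm → Set B` is a homomorphism into the powerset algebra `𝒫 B`. -/
structure IsHom {B : Type} [BooleanAlgebra B] (H : Fm → Set B) : Prop where
  ebot : H .ebot = ∅
  enot : ∀ φ, H (.enot φ) = (H φ)ᶜ
  eor  : ∀ φ ψ, H (.eor φ ψ) = H φ ∪ H ψ
  eand : ∀ φ ψ, H (.eand φ ψ) = H φ ∩ H ψ
  ibot : H .ibot = {(⊥ : B)}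
  inot : ∀ φ, H (.inot φ) = (fun a => aᶜ) '' H φ
  ior  : ∀ φ ψ, H (.ior φ ψ) = Set.image2 (· ⊔ ·) (H φ) (H ψ)
  iand : ∀ φ ψ, H (.iand φ ψ) = Set.image2 (· ⊓ ·) (H φ) (H ψ)

/-- Entailment in LT. -/
def Entails (Δ : Set Fm) (ψ : Fm) : Prop :=
  ∀ (B : Type) [BooleanAlgebra B] (H : Fm → Set B),
    IsHom H → (⋂ φ ∈ Δ, H φ) ⊆ H ψ

/-- Labels: classical propositional formulas. -/
inductive Lb where
  | var : ℕ → Lb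
  | bot : Lb
  | not : Lb → Lb
  | or  : Lb → Lb → Lb
  | and : Lb → Lb → Lb

/-- `h : Lb → B` is a label homomorphism (Boolean evaluation). -/
structure IsLbHom {B : Type} [BooleanAlgebra B] (h : Lb → B) : Prop where
  bot : h .bot = ⊥
  not : ∀ a, h (.not a) = (h a)ᶜ
  or  : ∀ a b, h (.or a b) = h a ⊔ h b
  and : ∀ a b, h (.and a b) = h a ⊓ h b

/-- Atomic labels occurring in a label. -/
def Lb.atoms : Lb → Set ℕ
  | var i => {i}
  | bot => ∅
  | not a => a.atoms
  | or a b => a.atoms ∪ b.atoms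
  | and a b => a.atoms ∪ b.atoms

/-- Two-valued (classical) evaluation of labels, for the tautology side condition. -/
def Lb.evalBool (v : ℕ → Bool) : Lb → Bool
  | var i => v i
  | bot => false
  | not a => !(a.evalBool v)
  | or a b => a.evalBool v || b.evalBool v
  | and a b => a.evalBool v && b.evalBool v

/-- The internal top `i⊤ = i¬ i⊥`. -/
def Fm.itop : Fm := .inot .ibot

/-- The labelled formula `a = b`, i.e. `(a∨¬b)∧(¬a∨b) : i⊤`. -/
def lbEq (a b : Lb) : Lb × Fm :=
  (Lb.and (Lb.or a (Lb.not b)) (Lb.or (Lb.not a) b), Fm.itop)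

/-- The labelled natural deduction system for LT. -/
inductive Proves : Set (Lb × Fm) → Lb × Fm → Prop where
  | hyp {Γ c} : c ∈ Γ → Proves Γ c
  | eandI {Γ a φ ψ} : Proves Γ (a, φ) → Proves Γ (a, ψ) →
      Proves Γ (a, Fm.eand φ ψ)
  | eandE1 {Γ a φ ψ} : Proves Γ (a, Fm.eand φ ψ) → Proves Γ (a, φ)
  | eandE2 {Γ a φ ψ} : Proves Γ (a, Fm.eand φ ψ) → Proves Γ (a, ψ)
  | eorI1 {Γ a φ ψ} : Proves Γ (a, φ) → Proves Γ (a, Fm.eor φ ψ)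
  | eorI2 {Γ a φ ψ} : Proves Γ (a, ψ) → Proves Γ (a, Fm.eor φ ψ)
  | eorE {Γ a b φ ψ σ} : Proves Γ (a, Fm.eor φ ψ) →
      Proves (insert (a, φ) Γ) (b, σ) → Proves (insert (a, ψ) Γ) (b, σ) →
      Proves Γ (b, σ)
  | enotI {Γ a b φ} : Proves (insert (a, φ) Γ) (b, Fm.ebot) →
      Proves Γ (a, Fm.enot φ)
  | enotE {Γ a φ} : Proves Γ (a, φ) → Proves Γ (a, Fm.enot φ) →
      Proves Γ (a, Fm.ebot)
  | raa {Γ a b φ} : Proves (insert (a, Fm.enot φ) Γ) (b, Fm.ebot) →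
      Proves Γ (a, φ)
  | botE {Γ a b φ} : Proves Γ (a, Fm.ebot) → Proves Γ (b, φ)
  | iandI {Γ a b φ ψ} : Proves Γ (a, φ) → Proves Γ (b, ψ) →
      Proves Γ (Lb.and a b, Fm.iand φ ψ)
  | iandE {Γ} {a b : Lb} {p q : ℕ} {φ ψ σ : Fm} :
      p ≠ q →
      (∀ r ∈ Γ, p ∉ (Prod.fst r).atoms ∧ q ∉ (Prod.fst r).atoms) →
      p ∉ a.atoms → q ∉ a.atoms → p ∉ b.atoms → q ∉ b.atoms →
      Proves Γ (a, Fm.iand φ ψ) →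
      Proves (insert (Lb.var p, φ) (insert (Lb.var q, ψ)
        (insert (lbEq a (Lb.and (Lb.var p) (Lb.var q))) Γ))) (b, σ) →
      Proves Γ (b, σ)
  | iorI {Γ a b φ ψ} : Proves Γ (a, φ) → Proves Γ (b, ψ) →
      Proves Γ (Lb.or a b, Fm.ior φ ψ)
  | iorE {Γ} {a b : Lb} {p q : ℕ} {φ ψ σ : Fm} :
      p ≠ q →
      (∀ r ∈ Γ, p ∉ (Prod.fst r).atoms ∧ q ∉ (Prod.fst r).atoms) →
      p ∉ a.atoms → q ∉ a.atoms → p ∉ b.atoms → q ∉ b.atoms →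
      Proves Γ (a, Fm.ior φ ψ) →
      Proves (insert (Lb.var p, φ) (insert (Lb.var q, ψ)
        (insert (lbEq a (Lb.or (Lb.var p) (Lb.var q))) Γ))) (b, σ) →
      Proves Γ (b, σ)
  | inotI {Γ a φ} : Proves Γ (a, φ) → Proves Γ (Lb.not a, Fm.inot φ)
  | inotE {Γ a φ} : Proves Γ (a, Fm.inot φ) → Proves Γ (Lb.not a, φ)
  | taut {Γ b} (L : List Lb) :
      (∀ a ∈ L, Proves Γ (a, Fm.itop)) →
      (∀ v : ℕ → Bool, (∀ a ∈ L, a.evalBool v = true) → b.evalBool v = true) →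
      Proves Γ (b, Fm.itop)
  | sub {Γ a b φ} : Proves Γ (lbEq a b) → Proves Γ (b, φ) → Proves Γ (a, φ)

/-- Semantic entailment for labelled formulas. -/
def LEntails (Γ : Set (Lb × Fm)) (c : Lb × Fm) : Prop :=
  ∀ (B : Type) [BooleanAlgebra B] (h : Lb → B) (H : Fm → Set B),
    IsLbHom h → IsHom H →
    (∀ r ∈ Γ, h r.1 ∈ H r.2) → h c.1 ∈ H c.2

/-- Consistency of a set of labelled formulas. -/
def Consistent (Γ : Set (Lb × Fm)) : Prop := ¬ Proves Γ (Lb.bot, Fm.ebot)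

/-- Strict negation on subsets of a Boolean algebra. -/
def sNeg {B : Type} [BooleanAlgebra B] (A : Set B) : Set B :=
  {b | ∀ a ∈ A, b ⊓ a = ⊥}

/-- Strict negation as a defined LT connective:
`∼φ = ¬(((φ i∧ ¬⊥) ∧ ¬ i⊥) i∨ ¬⊥)`. -/
def Fm.snot (φ : Fm) : Fm :=
  .enot (.ior (.eand (.iand φ (.enot .ebot)) (.enot .ibot)) (.enot .ebot))

/-- The possibility operator `◇φ := (φ i∧ ¬⊥) i∨ ¬⊥`. -/
def Fm.diam (φ : Fm) : Fm := .ior (.iand φ (.enot .ebot)) (.enot .ebot)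

/-- The necessity operator `□φ := ¬◇¬φ`. -/
def Fm.box (φ : Fm) : Fm := .enot (Fm.diam (.enot φ))

/-- The evaluation homomorphism determined by a variable assignment. -/
def Fm.eval {B : Type} [BooleanAlgebra B] (v : ℕ → Set B) : Fm → Set B
  | .var i => v i
  | .ebot => ∅
  | .enot φ => (φ.eval v)ᶜ
  | .eor φ ψ => φ.eval v ∪ ψ.eval v
  | .eand φ ψ => φ.eval v ∩ ψ.eval v
  | .ibot => {⊥}
  | .inot φ => (fun a => aᶜ) '' φ.eval v
  | .ior φ ψ => Set.image2 (· ⊔ ·) (φ.eval v) (ψ.eval v)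
  | .iand φ ψ => Set.image2 (· ⊓ ·) (φ.eval v) (ψ.eval v)

/-- A homomorphism has principal variables if every variable is sent to a
(non-empty) principal ideal. -/
def PrincipalVars {B : Type} [BooleanAlgebra B] (H : Fm → Set B) : Prop :=
  ∀ i, ∃ b : B, H (.var i) = {a | a ≤ b}

/-- PT⁺ formulas. -/
inductive PTFm where
  | var     : ℕ → PTFm
  | snotVar : ℕ → PTFm
  | ibot    : PTFm
  | nb      : PTFm
  | ior     : PTFm → PTFm → PTFm
  | eand    : PTFm → PTFm → PTFm
  | eor     : PTFm → PTFm → PTFm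

/-- PT⁺ formulas as LT formulas. -/
def PTFm.toFm : PTFm → Fm
  | .var i => .var i
  | .snotVar i => Fm.snot (.var i)
  | .ibot => .ibot
  | .nb => .enot .ibot
  | .ior φ ψ => .ior φ.toFm ψ.toFm
  | .eand φ ψ => .eand φ.toFm ψ.toFm
  | .eor φ ψ => .eor φ.toFm ψ.toFm

/-- Valuational team-semantic denotations of PT⁺ formulas. -/
def PTFm.den : PTFm → Set (Set (ℕ → Bool))
  | .var i => {X | ∀ s ∈ X, s i = true}
  | .snotVar i => {X | ∀ s ∈ X, s i = false}
  | .ibot => {∅}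
  | .nb => {X | X ≠ ∅}
  | .ior φ ψ => Set.image2 (· ∪ ·) φ.den ψ.den
  | .eand φ ψ => φ.den ∩ ψ.den
  | .eor φ ψ => φ.den ∪ ψ.den

/-- PT⁺ entailment. -/
def PTEntails (Δ : Set PTFm) (φ : PTFm) : Prop :=
  (⋂ δ ∈ Δ, PTFm.den δ) ⊆ PTFm.den φ

/-- The valuation homomorphism `H_V : Fm → 𝒫(𝒫(2^ℕ))`. -/
def HV : Fm → Set (Set (ℕ → Bool)) :=
  Fm.eval (fun i => {X : Set (ℕ → Bool) | ∀ s ∈ X, s i = true})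

/-- The principal variable axioms. -/
def PVA : Set Fm :=
  Set.range (fun i => Fm.box (Fm.ior (Fm.var i) (Fm.snot (Fm.var i))))

/-- A substitution: an algebra endomorphism of the term algebra of formulas. -/
structure IsSubst (σ : Fm → Fm) : Prop where
  ebot : σ .ebot = .ebot
  enot : ∀ φ, σ (.enot φ) = .enot (σ φ)
  eor  : ∀ φ ψ, σ (.eor φ ψ) = .eor (σ φ) (σ ψ)
  eand : ∀ φ ψ, σ (.eand φ ψ) = .eand (σ φ) (σ ψ)
  ibot : σ .ibot = .ibot
  inot : ∀ φ, σ (.inot φ) = .inot (σ φ)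
  ior  : ∀ φ ψ, σ (.ior φ ψ) = .ior (σ φ) (σ ψ)
  iand : ∀ φ ψ, σ (.iand φ ψ) = .iand (σ φ) (σ ψ)

/-- A bundled homomorphism into the powerset of a Boolean algebra. -/
structure LTHom where
  carrier : Type
  inst : BooleanAlgebra carrier
  H : Fm → Set carrier
  isHom : @IsHom carrier inst H

/-- Local entailment of a single homomorphism. -/
def LTHom.localEntails (h : LTHom) (Δ : Set Fm) (φ : Fm) : Prop :=
  (⋂ δ ∈ Δ, h.H δ) ⊆ h.H φ

/-- Entailment relative to a class of homomorphisms. -/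
def ClassEntails (C : Set LTHom) (Δ : Set Fm) (φ : Fm) : Prop :=
  ∀ h ∈ C, h.localEntails Δ φ

/-- The class `C` of homomorphisms is definable by the set `Ax` of formulas. -/
def DefinableBy (C : Set LTHom) (Ax : Set Fm) : Prop :=
  ∀ h : LTHom, h ∈ C ↔ ∀ π ∈ Ax, h.H π = Set.univ

/-- The evaluation map of a variable assignment is a homomorphism. -/
theorem Fm.isHom_eval {B : Type} [BooleanAlgebra B] (v : ℕ → Set B) :
    IsHom (Fm.eval v) := by
  constructor <;> intros <;> rfl

/-- If `H` sends `φ` to the principal ideal of `b`, then `H (∼φ)` consists of the sets disjoint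
from `b`. -/
theorem IsHom.mem_snot_iff {T : Type} {H : Fm → Set (Set T)} (hH : IsHom H) {φ : Fm}
    {b : Set T} (hb : H φ = {a | a ≤ b}) (X : Set T) :
    X ∈ H φ.snot ↔ Disjoint X b := by
  simp only [Fm.snot, hH.enot, hH.ior, hH.eand, hH.iand, hH.ebot, hH.ibot, hb]
  rw [Set.disjoint_left, Set.mem_compl_iff]
  constructor
  · intro h x hx hxb
    refine h ⟨{x}, ⟨⟨b, Set.Subset.rfl, {x}, by simp, ?_⟩, ?_⟩, X, by simp, ?_⟩
    · simpa using hxb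
    · simp
    · simpa using hx
  · rintro h ⟨c, ⟨⟨a, ha, d, -, rfl⟩, hne⟩, u, -, rfl⟩
    obtain ⟨x, hxa, hxd⟩ := Set.nonempty_iff_ne_empty.mpr hne
    exact h (Or.inl ⟨hxa, hxd⟩) (ha hxa)

/-- An image is a union of members of two families exactly when the set itself is a union of
sets whose images are members of these families. -/
theorem image_mem_image2_union_iff {α β : Type*} (f : α → β) (P Q : Set (Set β)) (X : Set α) :
    f '' X ∈ Set.image2 (· ⊔ ·) P Q ↔
      X ∈ Set.image2 (· ⊔ ·) {Y | f '' Y ∈ P} {Z | f '' Z ∈ Q} := by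
  constructor
  · rintro ⟨A, hA, B, hB, hAB : A ∪ B = f '' X⟩
    have key : ∀ C ⊆ f '' X, f '' (X ∩ f ⁻¹' C) = C := fun C hC => by
      rw [Set.image_inter_preimage, Set.inter_eq_right.mpr hC]
    refine ⟨X ∩ f ⁻¹' A, ?_, X ∩ f ⁻¹' B, ?_, ?_⟩
    · rwa [Set.mem_ofPred_eq, key A (hAB ▸ Set.subset_union_left)]
    · rwa [Set.mem_ofPred_eq, key B (hAB ▸ Set.subset_union_right)]
    · change X ∩ f ⁻¹' A ∪ X ∩ f ⁻¹' B = X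
      rw [← Set.inter_union_distrib_left, ← Set.preimage_union, hAB]
      exact Set.inter_eq_left.mpr (Set.subset_preimage_image f X)
  · rintro ⟨Y, hY, Z, hZ, rfl⟩
    exact ⟨f '' Y, hY, f '' Z, hZ, (Set.image_union f Y Z).symm⟩

/-- Representation of principal-variable homomorphisms on powerset algebras by
the valuation homomorphism. -/
theorem representation_in_valuation_model (S : Type)
    (H : Fm → Set (Set S)) (hH : IsHom H) (hpv : PrincipalVars H) :
    ∃ f : S → (ℕ → Bool), ∀ (φ : PTFm) (X : Set S),
      X ∈ H φ.toFm ↔ (f '' X) ∈ HV φ.toFm := by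
  classical
  choose b hb using hpv
  have hV : IsHom HV := Fm.isHom_eval _
  have hVvar : ∀ i, HV (.var i) = {A | A ≤ {s : ℕ → Bool | s i = true}} := fun _ => rfl
  refine ⟨fun x i => decide (x ∈ b i), fun φ => ?_⟩
  induction φ with
  | var i =>
    intro X
    rw [PTFm.toFm, hb, hVvar]
    simp [Set.subset_def]
  | snotVar i =>
    intro X
    rw [PTFm.toFm, hH.mem_snot_iff (hb i), hV.mem_snot_iff (hVvar i)]
    simp [Set.disjoint_left]
  | ibot =>
    intro X
    simp [PTFm.toFm, hH.ibot, hV.ibot]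
  | nb =>
    intro X
    simp [PTFm.toFm, hH.enot, hV.enot, hH.ibot, hV.ibot]
  | ior φ ψ ihφ ihψ =>
    intro X
    rw [PTFm.toFm, hH.ior, hV.ior, image_mem_image2_union_iff, Set.ext ihφ, Set.ext ihψ]
    rfl
  | eand φ ψ ihφ ihψ =>
    intro X
    rw [PTFm.toFm, hH.eand, hV.eand]
    exact and_congr (ihφ X) (ihψ X)
  | eor φ ψ ihφ ihψ =>
    intro X
    rw [PTFm.toFm, hH.eor, hV.eor]
    exact or_congr (ihφ X) (ihψ X)
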